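/- For n ≤ 4, every doubly nonnegative n×n matrix is completely positive, i.e., CPPⁿ = DNNⁿ when n ≤ 4. -/

import Mathlib

open Matrix

/-- X is completely positive: a finite sum of outer products of nonnegative vectors. -/
def IsCompletelyPositive {n : ℕ} (X : Matrix (Fin n) (Fin n) ℝ) : Prop :=
  ∃ (m : ℕ) (y : Fin m → Fin n → ℝ), (∀ k i, 0 ≤ y k i) ∧
    X = ∑ k, vecMulVec (y k) (y k)

namespace IsCompletelyPositive

variable {n : ℕ}

theorem zero : IsCompletelyPositive (0 : Matrix (Fin n) (Fin n) ℝ) :=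
  ⟨0, fun _ _ => 0, fun _ _ => le_rfl, by simp⟩

theorem add {X Y : Matrix (Fin n) (Fin n) ℝ} (hX : IsCompletelyPositive X)
    (hY : IsCompletelyPositive Y) : IsCompletelyPositive (X + Y) := by
  obtain ⟨m, y, hy, rfl⟩ := hX
  obtain ⟨m', y', hy', rfl⟩ := hY
  refine ⟨m + m', Fin.append y y', fun k => ?_, by simp [Fin.sum_univ_add]⟩
  refine Fin.addCases (fun k i => ?_) (fun k i => ?_) k
  · simpa using hy k i
  · simpa using hy' k i

theorem smul_vecMulVec_self {t : ℝ} (ht : 0 ≤ t) {b : Fin n → ℝ} (hb : ∀ i, 0 ≤ b i) :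
    IsCompletelyPositive (t • vecMulVec b b) := by
  refine ⟨1, fun _ => √t • b, fun _ i => mul_nonneg (Real.sqrt_nonneg t) (hb i), ?_⟩
  ext i j
  simp only [Finset.univ_unique, Finset.sum_const, Finset.card_singleton, one_smul,
    vecMulVec_apply, Matrix.smul_apply, Pi.smul_apply, smul_eq_mul]
  linear_combination (-(b i * b j)) * Real.mul_self_sqrt ht

end IsCompletelyPositive

namespace Matrix

theorem vecMulVec_mulVec_apply {m n : Type*} [Fintype n] (a : m → ℝ) (b z : n → ℝ) :
    vecMulVec a b *ᵥ z = (b ⬝ᵥ z) • a := by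
  ext i
  simp only [mulVec, dotProduct, vecMulVec_apply, Pi.smul_apply, smul_eq_mul, Finset.sum_mul]
  exact Finset.sum_congr rfl fun j _ => by ring

theorem PosSemidef.apply_comm {n : Type*} {X : Matrix n n ℝ} (hX : X.PosSemidef) (i j : n) : X i j = X j i := by
  simpa using (hX.isHermitian.apply i j).symm

variable {n : Type*} [Fintype n] {X : Matrix n n ℝ}

theorem PosSemidef.mulVec_dotProduct (hX : X.PosSemidef) (u z : n → ℝ) :
    (X *ᵥ u) ⬝ᵥ z = u ⬝ᵥ (X *ᵥ z) := by
  have hT : Xᵀ = X := by ext i j; exact hX.apply_comm j i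
  rw [dotProduct_mulVec, ← mulVec_transpose, hT]

theorem PosSemidef.dotProduct_mulVec_self_nonneg (hX : X.PosSemidef) (z : n → ℝ) :
    0 ≤ z ⬝ᵥ (X *ᵥ z) := by
  simpa using hX.dotProduct_mulVec_nonneg z

theorem PosSemidef.mulVec_eq_zero_of_dotProduct_nonpos (hX : X.PosSemidef) {z : n → ℝ}
    (hz : z ⬝ᵥ (X *ᵥ z) ≤ 0) : X *ᵥ z = 0 := by
  refine (hX.dotProduct_mulVec_zero_iff z).1 ?_
  simpa using le_antisymm hz (hX.dotProduct_mulVec_self_nonneg z)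

/-- The Cauchy–Schwarz inequality for the form of `X`, as positivity of the deflated matrix. -/
theorem PosSemidef.sub_smul_vecMulVec (hX : X.PosSemidef) {u : n → ℝ} {t : ℝ} (ht : 0 ≤ t)
    (htu : t * (u ⬝ᵥ (X *ᵥ u)) ≤ 1) :
    (X - t • vecMulVec (X *ᵥ u) (X *ᵥ u)).PosSemidef := by
  refine PosSemidef.of_dotProduct_mulVec_nonneg ?_ fun z => ?_
  · ext i j
    simp [vecMulVec_apply, hX.apply_comm j i, mul_comm]
  · set s := u ⬝ᵥ (X *ᵥ z) with hs
    have hzu : z ⬝ᵥ (X *ᵥ u) = s := by rw [← hX.mulVec_dotProduct, dotProduct_comm]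
    have h := hX.dotProduct_mulVec_self_nonneg (z - (t * s) • u)
    simp only [mulVec_sub, mulVec_smul, sub_dotProduct, dotProduct_sub, smul_dotProduct,
      dotProduct_smul, smul_eq_mul, hzu, ← hs] at h
    simp only [star_trivial, sub_mulVec, smul_mulVec, vecMulVec_mulVec_apply, dotProduct_sub,
      dotProduct_smul, smul_eq_mul, hX.mulVec_dotProduct, hzu, ← hs]
    nlinarith [mul_le_mul_of_nonneg_left htu (mul_nonneg ht (sq_nonneg s))]

theorem PosSemidef.apply_eq_zero_of_diag_eq_zero [DecidableEq n] (hX : X.PosSemidef) {i : n}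
    (hi : X i i = 0) (j : n) : X j i = 0 := by
  have h := hX.mulVec_eq_zero_of_dotProduct_nonpos (z := Pi.single i 1) (by simp [hi])
  simpa using congrFun h j

/-- The rank of `X` plus the number of its nonzero entries. -/
noncomputable def rankAddSupport (X : Matrix n n ℝ) : ℕ :=
  X.rank + (Finset.univ.filter fun p : n × n => X p.1 p.2 ≠ 0).card

theorem rank_sub_smul_vecMulVec_le (X : Matrix n n ℝ) (u : n → ℝ) (t : ℝ) :
    (X - t • vecMulVec (X *ᵥ u) (X *ᵥ u)).rank ≤ X.rank := by
  refine Submodule.finrank_mono ?_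
  rintro _ ⟨z, rfl⟩
  refine ⟨z - (t * ((X *ᵥ u) ⬝ᵥ z)) • u, ?_⟩
  simp [mulVec_sub, mulVec_smul, vecMulVec_mulVec_apply, smul_smul]

theorem PosSemidef.rank_sub_smul_vecMulVec_lt (hX : X.PosSemidef) {u : n → ℝ} (hu : X *ᵥ u ≠ 0)
    {t : ℝ} (htu : t * (u ⬝ᵥ (X *ᵥ u)) = 1) :
    (X - t • vecMulVec (X *ᵥ u) (X *ᵥ u)).rank < X.rank := by
  set Y := X - t • vecMulVec (X *ᵥ u) (X *ᵥ u) with hY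
  have hlt : LinearMap.ker X.mulVecLin < LinearMap.ker Y.mulVecLin := by
    refine lt_of_le_of_ne (fun z hz => ?_) fun h => hu ?_
    · have hz' : X *ᵥ z = 0 := hz
      simp [hY, vecMulVec_mulVec_apply, hX.mulVec_dotProduct, hz']
    · have : u ∈ LinearMap.ker Y.mulVecLin := by
        simp [hY, vecMulVec_mulVec_apply, hX.mulVec_dotProduct,
          smul_smul, htu]
      rw [← h] at this
      exact this
  have h1 := Submodule.finrank_lt_finrank_of_lt hlt
  have hX' := X.mulVecLin.finrank_range_add_finrank_ker
  have hY' := Y.mulVecLin.finrank_range_add_finrank_ker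
  unfold Matrix.rank
  lia

/-- A nonnegative vector in the range of `X` supported on a clique of the graph of `X` can be
split off so that the rest stays doubly nonnegative and gets smaller. -/
theorem PosSemidef.exists_rankAddSupport_lt (hX : X.PosSemidef) (hnn : ∀ i j, 0 ≤ X i j)
    {u : n → ℝ} (hu : X *ᵥ u ≠ 0) (hb : ∀ i, 0 ≤ (X *ᵥ u) i)
    (hclique : ∀ i j, (X *ᵥ u) i ≠ 0 → (X *ᵥ u) j ≠ 0 → X i j ≠ 0) :
    ∃ t : ℝ, 0 ≤ t ∧ (X - t • vecMulVec (X *ᵥ u) (X *ᵥ u)).PosSemidef ∧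
      (∀ i j, 0 ≤ (X - t • vecMulVec (X *ᵥ u) (X *ᵥ u)) i j) ∧
      (X - t • vecMulVec (X *ᵥ u) (X *ᵥ u)).rankAddSupport < X.rankAddSupport := by
  set b := X *ᵥ u with hbdef
  have hq : 0 < u ⬝ᵥ b := by
    refine lt_of_not_ge fun h => hu (hX.mulVec_eq_zero_of_dotProduct_nonpos h)
  have hsupp : ∀ t : ℝ, (Finset.univ.filter fun p : n × n =>
      (X - t • vecMulVec b b) p.1 p.2 ≠ 0) ⊆ Finset.univ.filter fun p : n × n => X p.1 p.2 ≠ 0 := by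
    intro t p hp
    simp only [Finset.mem_filter, Finset.mem_univ, true_and] at hp ⊢
    intro h0
    have : b p.1 * b p.2 = 0 := by
      by_contra hne
      exact hclique _ _ (left_ne_zero_of_mul hne) (right_ne_zero_of_mul hne) h0
    exact hp (by simp [vecMulVec_apply, h0, this])
  by_cases hT : ∀ i j, (u ⬝ᵥ b)⁻¹ * (b i * b j) ≤ X i j
  · refine ⟨(u ⬝ᵥ b)⁻¹, by positivity, hX.sub_smul_vecMulVec (by positivity) ?_, ?_, ?_⟩
    · exact (inv_mul_cancel₀ hq.ne').le
    · intro i j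
      simpa [vecMulVec_apply] using hT i j
    · exact add_lt_add_of_lt_of_le (hX.rank_sub_smul_vecMulVec_lt hu (inv_mul_cancel₀ hq.ne'))
        (Finset.card_le_card (hsupp _))
  · push Not at hT
    obtain ⟨i₀, j₀, h₀⟩ := hT
    set S := Finset.univ.filter fun p : n × n => b p.1 * b p.2 ≠ 0
    have hmem : ∀ i j, (i, j) ∈ S ↔ b i * b j ≠ 0 := fun i j => by simp [S]
    have hij₀ : (i₀, j₀) ∈ S := by
      rw [hmem]
      intro h
      rw [h, mul_zero] at h₀
      exact absurd h₀ (not_lt.2 (hnn _ _))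
    obtain ⟨⟨i, j⟩, hij, hmin⟩ :=
      S.exists_min_image (fun p => X p.1 p.2 / (b p.1 * b p.2)) ⟨_, hij₀⟩
    have hpos : ∀ k l, (k, l) ∈ S → 0 < b k * b l := fun k l h =>
      lt_of_le_of_ne (mul_nonneg (hb k) (hb l)) ((hmem k l).1 h).symm
    have hij' := hpos i j hij
    set t := X i j / (b i * b j) with ht
    have ht0 : 0 ≤ t := div_nonneg (hnn i j) hij'.le
    have htq : t * (u ⬝ᵥ b) ≤ 1 := by
      have h1 : t ≤ (u ⬝ᵥ b)⁻¹ :=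
        (hmin _ hij₀).trans ((div_le_iff₀ (hpos _ _ hij₀)).2 h₀.le)
      calc t * (u ⬝ᵥ b) ≤ (u ⬝ᵥ b)⁻¹ * (u ⬝ᵥ b) := by gcongr
        _ = 1 := inv_mul_cancel₀ hq.ne'
    refine ⟨t, ht0, hX.sub_smul_vecMulVec ht0 htq, fun k l => ?_, ?_⟩
    · rw [sub_apply, smul_apply, vecMulVec_apply, smul_eq_mul, sub_nonneg]
      by_cases hkl : (k, l) ∈ S
      · exact (le_div_iff₀ (hpos k l hkl)).1 (hmin _ hkl)
      · rw [hmem, not_not] at hkl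
        rw [hkl, mul_zero]
        exact hnn k l
    · refine add_lt_add_of_le_of_lt (X.rank_sub_smul_vecMulVec_le u t)
        (Finset.card_lt_card ((hsupp t).ssubset_of_ne fun h => ?_))
      have h1 : (i, j) ∈ Finset.univ.filter fun p : n × n => X p.1 p.2 ≠ 0 := by
        simpa using hclique i j (left_ne_zero_of_mul hij'.ne') (right_ne_zero_of_mul hij'.ne')
      rw [← h] at h1
      simp [vecMulVec_apply, ht, div_mul_cancel₀ _ hij'.ne'] at h1

end Matrix

/-- In a reflexive symmetric relation on at most four points, either some point has pairwise
related neighbours or there are four points forming a cycle without chords. -/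
theorem exists_simplicial_or_fourCycle {n : ℕ} (hn : n ≤ 4) (r : Fin n → Fin n → Prop)
    (hsymm : ∀ i j, r i j → r j i) (hrefl : ∀ i j, r i j → r i i) {i : Fin n} (hi : r i i) :
    (∃ i, r i i ∧ ∀ j k, r i j → r i k → r j k) ∨
    ∃ i j k l, Finset.univ = {i, j, k, l} ∧ i ≠ j ∧ i ≠ k ∧ i ≠ l ∧ j ≠ k ∧ j ≠ l ∧ k ≠ l ∧
      r i j ∧ r i k ∧ r j l ∧ r k l ∧ ¬ r j k ∧ ¬ r i l := by
  by_contra! h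
  obtain ⟨h, hcycle⟩ := h
  obtain ⟨j, k, hij, hik, hjk⟩ := h i hi
  have hjj := hrefl _ _ (hsymm _ _ hij)
  have hkk := hrefl _ _ (hsymm _ _ hik)
  have hij' : i ≠ j := by rintro rfl; exact hjk hik
  have hik' : i ≠ k := by rintro rfl; exact hjk (hsymm _ _ hij)
  have hjk' : j ≠ k := by rintro rfl; exact hjk hjj
  have hfive : ∀ p q, p ≠ i → p ≠ j → p ≠ k → q ≠ i → q ≠ j → q ≠ k → p = q := by
    intro p q _ _ _ _ _ _
    by_contra hpq
    have hcard : ({i, j, k, p, q} : Finset (Fin n)).card = 5 := by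
      repeat rw [Finset.card_insert_of_notMem (by simp; grind)]
      simp
    have := Finset.card_le_univ ({i, j, k, p, q} : Finset (Fin n))
    simp only [Fintype.card_fin] at this
    lia
  have key : ∀ a b, (∀ p, p ≠ a → p ≠ b → p ≠ j ∧ p ≠ k) → ¬ r a b → r a a →
      ∃ l, l ≠ i ∧ l ≠ a ∧ l ≠ b ∧ r a l ∧ ¬ r i l := by
    intro a b hab hnab haa
    obtain ⟨p, q, hp, hq, hpq⟩ := h a haa
    have hpa : p ≠ a := by rintro rfl; exact hpq hq
    have hqa : q ≠ a := by rintro rfl; exact hpq (hsymm _ _ hp)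
    have hpb : p ≠ b := by rintro rfl; exact hnab hp
    have hqb : q ≠ b := by rintro rfl; exact hnab hq
    have hne : p ≠ q := by rintro rfl; exact hpq (hrefl _ _ (hsymm _ _ hp))
    by_cases hpi : p = i
    · subst hpi
      exact ⟨q, hne.symm, hqa, hqb, hq, hpq⟩
    · by_cases hqi : q = i
      · subst hqi
        exact ⟨p, hpi, hpa, hpb, hp, fun h => hpq (hsymm _ _ h)⟩
      · obtain ⟨hpj, hpk⟩ := hab p hpa hpb
        obtain ⟨hqj, hqk⟩ := hab q hqa hqb
        exact absurd (hfive p q hpi hpj hpk hqi hqj hqk) hne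
  obtain ⟨l, hli, hlj, hlk, hjl, hil⟩ := key j k (fun p h1 h2 => ⟨h1, h2⟩) hjk hjj
  obtain ⟨l', hli', hlk', hlj', hkl, -⟩ := key k j (fun p h1 h2 => ⟨h2, h1⟩)
    (fun h => hjk (hsymm _ _ h)) hkk
  obtain rfl := hfive l l' hli hlj hlk hli' hlj' hlk'
  refine hil (hcycle i j k l ?_ hij' hik' hli.symm hjk' hlj.symm hlk.symm hij hik hjl hkl hjk)
  ext p
  simp only [Finset.mem_univ, Finset.mem_insert, Finset.mem_singleton, true_iff]
  by_contra! hp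
  exact hp.2.2.2 (hfive p l hp.1 hp.2.1 hp.2.2.1 hli hlj hlk)

/-- A singular doubly nonnegative matrix whose graph is a chordless four-cycle is a sum of rank
one matrices supported on the edges. -/
theorem IsCompletelyPositive.of_fourCycle_of_mulVec_eq_zero {n : ℕ}
    {X : Matrix (Fin n) (Fin n) ℝ} (hX : X.PosSemidef) (hnn : ∀ i j, 0 ≤ X i j)
    {i j k l : Fin n} (huniv : Finset.univ = {i, j, k, l})
    (hij : i ≠ j) (hik : i ≠ k) (hil : i ≠ l) (hjk : j ≠ k) (hjl : j ≠ l) (hkl : k ≠ l)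
    (xij : X i j ≠ 0) (xik : X i k ≠ 0) (xjl : X j l ≠ 0) (xkl : X k l ≠ 0)
    (xjk : X j k = 0) (xil : X i l = 0) {z : Fin n → ℝ} (hz : z ≠ 0) (hXz : X *ᵥ z = 0) :
    IsCompletelyPositive X := by
  have hsum : ∀ f : Fin n → ℝ, ∑ p, f p = f i + f j + f k + f l := by
    intro f
    rw [huniv, Finset.sum_insert (by simp [*]), Finset.sum_insert (by simp [*]),
      Finset.sum_insert (by simp [*]), Finset.sum_singleton]
    ring
  have hcases : ∀ p, p = i ∨ p = j ∨ p = k ∨ p = l := fun p => by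
    simpa [huniv] using Finset.mem_univ p
  have xji := hX.apply_comm j i
  have xki := hX.apply_comm k i
  have xlj := hX.apply_comm l j
  have xlk := hX.apply_comm l k
  have xkj := (hX.apply_comm k j).trans xjk
  have xli := (hX.apply_comm l i).trans xil
  have pij := lt_of_le_of_ne (hnn i j) xij.symm
  have pik := lt_of_le_of_ne (hnn i k) xik.symm
  have pjl := lt_of_le_of_ne (hnn j l) xjl.symm
  have pkl := lt_of_le_of_ne (hnn k l) xkl.symm
  -- the kernel vector with the sign pattern of the bipartition
  set y : Fin n → ℝ := fun p => if p = i ∨ p = l then |z p| else -|z p| with hy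
  have yi : y i = |z i| := by simp [hy]
  have yj : y j = -|z j| := by simp [hy, hij.symm, hjl]
  have yk : y k = -|z k| := by simp [hy, hik.symm, hkl]
  have yl : y l = |z l| := by simp [hy]
  have hXy : X *ᵥ y = 0 := by
    refine hX.mulVec_eq_zero_of_dotProduct_nonpos ?_
    have h0 : z ⬝ᵥ (X *ᵥ z) = 0 := by rw [hXz, dotProduct_zero]
    have hab : ∀ a b : ℝ, 0 ≤ |a| * |b| + a * b := fun a b => by
      rw [← abs_mul]; linarith [neg_abs_le (a * b)]
    have hsq : ∀ p, X p p * (|z p| * |z p|) = X p p * (z p * z p) := fun p => by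
      rw [abs_mul_abs_self]
    simp only [dotProduct, mulVec, hsum, yi, yj, yk, yl, xji, xki, xlj, xlk, xjk, xkj, xil, xli]
      at h0 ⊢
    linarith [mul_nonneg pij.le (hab (z i) (z j)), mul_nonneg pik.le (hab (z i) (z k)),
      mul_nonneg pjl.le (hab (z j) (z l)), mul_nonneg pkl.le (hab (z k) (z l)),
      hsq i, hsq j, hsq k, hsq l]
  have ei := congrFun hXy i
  have ej := congrFun hXy j
  have ek := congrFun hXy k
  have el := congrFun hXy l
  simp only [dotProduct, mulVec, hsum, yi, yj, yk, yl, xji, xki, xlj, xlk, xjk, xkj, xil, xli,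
    Pi.zero_apply] at ei ej ek el
  have hz4 : ¬ (|z i| = 0 ∧ |z j| = 0 ∧ |z k| = 0 ∧ |z l| = 0) := by
    rintro ⟨h1, h2, h3, h4⟩
    refine hz (funext fun p => ?_)
    rcases hcases p with rfl | rfl | rfl | rfl <;> exact abs_eq_zero.1 (by assumption)
  have ni := abs_nonneg (z i)
  have nj := abs_nonneg (z j)
  have nk := abs_nonneg (z k)
  have nl := abs_nonneg (z l)
  generalize |z i| = a at *
  generalize |z j| = b at *
  generalize |z k| = c at *
  generalize |z l| = d at *
  -- vanishing propagates along the cycle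
  have hprop : ∀ x y s t : ℝ, 0 < x → 0 < y → 0 ≤ s → 0 ≤ t → x * s + y * t = 0 →
      s = 0 ∧ t = 0 := by
    intro x y s t hx hy hs ht h
    have h1 := mul_nonneg hx.le hs
    have h2 := mul_nonneg hy.le ht
    exact ⟨(mul_eq_zero.1 (by linarith)).resolve_left hx.ne',
      (mul_eq_zero.1 (by linarith)).resolve_left hy.ne'⟩
  have fi : a = 0 → b = 0 ∧ c = 0 := fun h =>
    hprop _ _ _ _ pij pik nj nk (by rw [h] at ei; linarith)
  have fj : b = 0 → a = 0 ∧ d = 0 := fun h =>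
    hprop _ _ _ _ pij pjl ni nl (by rw [h] at ej; linarith)
  have fk : c = 0 → a = 0 ∧ d = 0 := fun h =>
    hprop _ _ _ _ pik pkl ni nl (by rw [h] at ek; linarith)
  have fl : d = 0 → b = 0 ∧ c = 0 := fun h =>
    hprop _ _ _ _ pjl pkl nj nk (by rw [h] at el; linarith)
  have ha : 0 < a := lt_of_le_of_ne ni (by grind)
  have hb : 0 < b := lt_of_le_of_ne nj (by grind)
  have hc : 0 < c := lt_of_le_of_ne nk (by grind)
  have hd : 0 < d := lt_of_le_of_ne nl (by grind)
  have hedge : ∀ (p q : Fin n) (s t : ℝ), 0 < s → 0 < t → IsCompletelyPositive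
      ((X p q / (s * t)) • vecMulVec (Pi.single p t + Pi.single q s)
        (Pi.single p t + Pi.single q s)) := by
    intro p q s t hs ht
    refine smul_vecMulVec_self (div_nonneg (hnn p q) (mul_pos hs ht).le) fun m => ?_
    simp only [Pi.add_apply, Pi.single_apply]
    split_ifs <;> positivity
  have hdecomp := (((hedge i j a b ha hb).add (hedge i k a c ha hc)).add
    (hedge j l b d hb hd)).add (hedge k l c d hc hd)
  convert hdecomp using 1
  have hji := hij.symm
  have hki := hik.symm
  have hli := hil.symm
  have hkj := hjk.symm
  have hlj := hjl.symm
  have hlk := hkl.symm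
  ext p q
  simp only [Matrix.add_apply, Matrix.smul_apply, vecMulVec_apply, Pi.add_apply, Pi.single_apply,
    smul_eq_mul]
  rcases hcases p with rfl | rfl | rfl | rfl <;> rcases hcases q with rfl | rfl | rfl | rfl <;>
    simp [hij, hik, hil, hjk, hjl, hkl, hji, hki, hli, hkj, hlj, hlk, xji, xki, xlj, xlk, xjk, xkj,
      xil, xli] <;> field_simp <;> linarith

theorem stmt_2 {n : ℕ} (hn : n ≤ 4) (X : Matrix (Fin n) (Fin n) ℝ)
    (hpsd : X.PosSemidef) (hnn : ∀ i j, 0 ≤ X i j) :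
    IsCompletelyPositive X := by
  induction hN : X.rankAddSupport using Nat.strong_induction_on generalizing X with
  | _ N ih =>
  subst hN
  have reduce : ∀ u : Fin n → ℝ, X *ᵥ u ≠ 0 → (∀ i, 0 ≤ (X *ᵥ u) i) →
      (∀ i j, (X *ᵥ u) i ≠ 0 → (X *ᵥ u) j ≠ 0 → X i j ≠ 0) → IsCompletelyPositive X := by
    intro u hu hb hclique
    obtain ⟨t, ht, hY, hYnn, hlt⟩ := hpsd.exists_rankAddSupport_lt hnn hu hb hclique
    simpa using (ih _ hlt _ hY hYnn rfl).add (.smul_vecMulVec_self ht hb)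
  by_cases hdiag : ∃ i, X i i ≠ 0
  · obtain ⟨i, hi⟩ := hdiag
    rcases exists_simplicial_or_fourCycle hn (fun i j => X i j ≠ 0)
      (fun i j h => by rwa [hpsd.apply_comm j i])
      (fun i j h h0 => h (by rw [hpsd.apply_comm i j, hpsd.apply_eq_zero_of_diag_eq_zero h0]))
      hi with ⟨i, hi, hsimp⟩ | ⟨i, j, k, l, huniv, hij, hik, hil, hjk, hjl, hkl, xij, xik, xjl,
        xkl, xjk, xil⟩
    · have hcol : ∀ p, (X *ᵥ Pi.single i 1) p = X i p := fun p => by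
        simp [hpsd.apply_comm i p]
      refine reduce (Pi.single i 1) (fun h => hi ?_) (fun p => ?_) fun p q hp hq => ?_
      · rw [← hcol, h, Pi.zero_apply]
      · rw [hcol]; exact hnn i p
      · rw [hcol] at hp hq
        exact hsimp p q hp hq
    · by_cases hsing : ∃ z, z ≠ 0 ∧ X *ᵥ z = 0
      · obtain ⟨z, hz, hXz⟩ := hsing
        exact .of_fourCycle_of_mulVec_eq_zero hpsd hnn huniv hij hik hil hjk hjl hkl xij xik xjl
          xkl (not_not.1 xjk) (not_not.1 xil) hz hXz
      · have hinj : Function.Injective X.mulVecLin := by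
          rw [← LinearMap.ker_eq_bot, LinearMap.ker_eq_bot']
          intro z hz
          by_contra hne
          exact hsing ⟨z, hne, hz⟩
        obtain ⟨u, hu⟩ := LinearMap.surjective_of_injective hinj (Pi.single i 1)
        replace hu : X *ᵥ u = Pi.single i 1 := hu
        refine reduce u (by simp [hu]) (fun p => ?_) fun p q hp hq => ?_
        · rw [hu, Pi.single_apply]
          split_ifs <;> norm_num
        · rw [hu, Pi.single_apply] at hp hq
          obtain rfl : p = i := by by_contra h; simp [h] at hp
          obtain rfl : q = p := by by_contra h; simp [h] at hq
          exact fun h0 => xij (by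
            rw [hpsd.apply_comm, hpsd.apply_eq_zero_of_diag_eq_zero h0])
  · push Not at hdiag
    have hX0 : X = 0 := by
      ext i j
      exact hpsd.apply_eq_zero_of_diag_eq_zero (hdiag j) i
    rw [hX0]
    exact .zero
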